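/- Let C_{2n+1} be the odd cycle on vertices x_1,…,x_{2n+1} and let t satisfy n+2 ≤ t ≤ 2n+1. Then every monomial in the set D(t) has degree exactly 2t−1, and the cardinality of D(t) equals Σ_{ℓ=1}^{2n+1} C(2n+1, ℓ)·C(t−n−2, t−n−1−ℓ), where C(a+b−1, b) counts the multisets of size b from ℓ elements, i.e. |D(t)| = Σ_{ℓ=1}^{2n+1} (2n+1 choose ℓ)·((ℓ multichoose t−(n+1)−ℓ)) with ((a multichoose b)) = (a+b−1 choose b). Consequently the symbolic defect sdefect(I(C_{2n+1}), t), the minimal number of generators of I^(t)/I^t, equals this sum. -/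

import Mathlib

open MvPolynomial

noncomputable section

/-- The ideal generated by the variables indexed by `S`. -/
def varIdeal (K : Type*) [Field K] (N : ℕ) (S : Finset (Fin N)) :
    Ideal (MvPolynomial (Fin N) K) :=
  Ideal.span ((fun i => (X i : MvPolynomial (Fin N) K)) '' S)

/-- The edge ideal of a graph `G`, generated by `X i * X j` for edges `{i, j}`. -/
def edgeIdeal (K : Type*) [Field K] {N : ℕ} (G : SimpleGraph (Fin N)) :
    Ideal (MvPolynomial (Fin N) K) :=
  Ideal.span {p | ∃ i j, G.Adj i j ∧ p = X i * X j}

/-- `S` is a vertex cover of `G`: every edge meets `S`. -/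
def IsVertexCover {N : ℕ} (G : SimpleGraph (Fin N)) (S : Finset (Fin N)) : Prop :=
  ∀ ⦃i j : Fin N⦄, G.Adj i j → i ∈ S ∨ j ∈ S

/-- `S` is a minimal vertex cover of `G`. -/
def IsMinVertexCover {N : ℕ} (G : SimpleGraph (Fin N)) (S : Finset (Fin N)) : Prop :=
  IsVertexCover G S ∧ ∀ T ⊂ S, ¬ IsVertexCover G T

/-- The `t`-th symbolic power of the edge ideal of `G`:
the intersection of the `t`-th powers of the minimal vertex cover primes. -/
def symbolicPower (K : Type*) [Field K] {N : ℕ} (G : SimpleGraph (Fin N)) (t : ℕ) :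
    Ideal (MvPolynomial (Fin N) K) :=
  ⨅ (S : Finset (Fin N)) (_ : IsMinVertexCover G S), varIdeal K N S ^ t

/-- The cycle graph on `Fin m`, with edges `{i, i+1 mod m}`. -/
def cycleGraph (m : ℕ) : SimpleGraph (Fin m) :=
  SimpleGraph.fromRel (fun i j => (j : ℕ) = ((i : ℕ) + 1) % m)

/-- The set `L(t)` of monomials of degree at least `2t` whose weight with respect to every
minimal vertex cover is at least `t`. -/
def Lset (K : Type*) [Field K] {N : ℕ} (G : SimpleGraph (Fin N)) (t : ℕ) :
    Set (MvPolynomial (Fin N) K) :=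
  {p | ∃ a : Fin N →₀ ℕ, p = monomial a 1 ∧ 2 * t ≤ ∑ i, a i ∧
    ∀ S : Finset (Fin N), IsMinVertexCover G S → t ≤ ∑ i ∈ S, a i}

/-- The set `D(t)` of monomials of degree less than `2t` whose weight with respect to every
minimal vertex cover is at least `t`. -/
def Dset (K : Type*) [Field K] {N : ℕ} (G : SimpleGraph (Fin N)) (t : ℕ) :
    Set (MvPolynomial (Fin N) K) :=
  {p | ∃ a : Fin N →₀ ℕ, p = monomial a 1 ∧ (∑ i, a i) < 2 * t ∧
    ∀ S : Finset (Fin N), IsMinVertexCover G S → t ≤ ∑ i ∈ S, a i}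

/-- `α(J)`: the least total degree of a nonzero polynomial in `J`. -/
def alphaDeg {K : Type*} [Field K] {N : ℕ} (J : Ideal (MvPolynomial (Fin N) K)) : ℕ :=
  sInf {d | ∃ f ∈ J, f ≠ 0 ∧ f.totalDegree = d}

/-- The symbolic defect: the minimal number of generators one must add to `I(G)^t`
to obtain the symbolic power `I(G)^(t)`. -/
def sdefect (K : Type*) [Field K] {N : ℕ} (G : SimpleGraph (Fin N)) (t : ℕ) : ℕ :=
  sInf {c | ∃ F : Finset (MvPolynomial (Fin N) K), F.card = c ∧
    symbolicPower K G t = edgeIdeal K G ^ t + Ideal.span (F : Set (MvPolynomial (Fin N) K))}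

/-- The graph consisting of the odd cycle on vertices `0, …, 2n` (that is,
`x_1, …, x_{2n+1}`) together with one extra vertex `2n+1` (that is, `x_{2n+2}`)
joined to vertex `0` (that is, `x_1`) by an edge. -/
def appendedCycle (n : ℕ) : SimpleGraph (Fin (2 * n + 2)) :=
  SimpleGraph.fromRel (fun i j =>
    ((j : ℕ) = (i : ℕ) + 1 ∧ (j : ℕ) ≤ 2 * n) ∨
    ((i : ℕ) = 2 * n ∧ (j : ℕ) = 0) ∨
    ((i : ℕ) = 0 ∧ (j : ℕ) = 2 * n + 1))

/-- weight of every vertex cover is at least `t` -/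
def CovW {N : ℕ} (G : SimpleGraph (Fin N)) (t : ℕ) (a : Fin N → ℕ) : Prop :=
  ∀ S : Finset (Fin N), IsVertexCover G S → t ≤ ∑ i ∈ S, a i

lemma exists_minCover {N : ℕ} (G : SimpleGraph (Fin N)) (S : Finset (Fin N))
    (hS : IsVertexCover G S) : ∃ T ⊆ S, IsMinVertexCover G T := by
  induction S using Finset.strongInduction with
  | H S ih =>
    by_cases h : ∃ T ⊂ S, IsVertexCover G T
    · obtain ⟨T, hT, hc⟩ := h
      obtain ⟨T', h1, h2⟩ := ih T hT hc
      exact ⟨T', h1.trans hT.subset, h2⟩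
    · push Not at h
      exact ⟨S, subset_rfl, hS, h⟩

lemma covW_iff {N : ℕ} (G : SimpleGraph (Fin N)) (t : ℕ) (a : Fin N → ℕ) :
    CovW G t a ↔ ∀ S : Finset (Fin N), IsMinVertexCover G S → t ≤ ∑ i ∈ S, a i := by
  constructor
  · intro h S hS
    exact h S hS.1
  · intro h S hS
    obtain ⟨T, hT, hm⟩ := exists_minCover G S hS
    exact (h T hm).trans (Finset.sum_le_sum_of_subset hT)

/-- Set and collection lemma, in descent form. -/
lemma core_corona {N : ℕ} (G : SimpleGraph (Fin N)) (t : ℕ) (a : Fin N → ℕ)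
    (h : CovW G t a)
    (htight : ∀ i, 0 < a i → ∃ S, IsVertexCover G S ∧ i ∈ S ∧ ∑ j ∈ S, a j ≤ t)
    (A B : Finset (Fin N)) (hAB : A ⊆ B) (hadj : ∀ i ∈ A, ∀ j ∈ B, ¬ G.Adj i j)
    (hw : 2 * ∑ i, a i ≤ 2 * t + ∑ i ∈ A, a i + ∑ i ∈ B, a i) :
    ∑ i, a i ≤ 2 * t := by
  induction A using Finset.strongInduction generalizing B with
  | H A ih =>
    by_cases hz : ∃ i ∈ A, 0 < a i
    · obtain ⟨i, hiA, hi⟩ := hz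
      obtain ⟨S, hS, hiS, hSt⟩ := htight i hi
      have hT : ∀ x ∉ S, ∀ y ∉ S, ¬ G.Adj x y := by
        intro x hx y hy hxy
        rcases hS hxy with h | h <;> contradiction
      refine ih (A \ S) ?_ (B ∪ Sᶜ) ?_ ?_ ?_
      · exact ⟨Finset.sdiff_subset, fun hh => (Finset.mem_sdiff.1 (hh hiA)).2 hiS⟩
      · intro x hx
        exact Finset.mem_union_left _ (hAB (Finset.mem_sdiff.1 hx).1)
      · intro x hx y hy
        rw [Finset.mem_sdiff] at hx
        rcases Finset.mem_union.1 hy with hy | hy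
        · exact hadj x hx.1 y hy
        · exact hT x hx.2 y (by simpa using hy)
      · -- the cover complementary to `(B \ S) ∪ A`
        have hc : IsVertexCover G ((S ∪ Bᶜ) \ A) := by
          intro x y hxy
          have h1 := hS hxy
          have h2 := hadj x
          have h3 := hadj y
          by_cases hxA : x ∈ A
          · right
            have := fun hy => hadj x hxA y hy hxy
            simp only [Finset.mem_sdiff, Finset.mem_union, Finset.mem_compl]
            exact ⟨Or.inr this, fun hy => this (hAB hy)⟩
          · by_cases hyA : y ∈ A
            · left
              have := fun hx => hadj y hyA x hx hxy.symm
              simp only [Finset.mem_sdiff, Finset.mem_union, Finset.mem_compl]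
              exact ⟨Or.inr this, hxA⟩
            · simp only [Finset.mem_sdiff, Finset.mem_union, Finset.mem_compl]
              tauto
        have hcw := h _ hc
        have key : ∑ j ∈ (S ∪ Bᶜ) \ A, a j + ∑ j ∈ A, a j + ∑ j ∈ B, a j
            ≤ ∑ j ∈ S, a j + (∑ j ∈ A \ S, a j + ∑ j ∈ B ∪ Sᶜ, a j) := by
          have e : ∀ s : Finset (Fin N), ∑ j ∈ s, a j = ∑ j, if j ∈ s then a j else 0 := by
            intro s; simp
          simp only [e]
          simp only [← Finset.sum_add_distrib]
          refine Finset.sum_le_sum fun j _ => ?_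
          have := @hAB j
          simp only [Finset.mem_sdiff, Finset.mem_union, Finset.mem_compl]
          by_cases hA : j ∈ A
          · have hB := this hA
            by_cases hS : j ∈ S <;> simp [hA, hB, hS]
          · by_cases hB : j ∈ B <;> by_cases hS : j ∈ S <;> simp [hA, hB, hS]
        omega
    · push Not at hz
      have h0 : ∑ i ∈ A, a i = 0 := Finset.sum_eq_zero fun i hi => by
        have := hz i hi; omega
      have h1 : ∑ i ∈ B, a i ≤ ∑ i, a i := Finset.sum_le_sum_of_subset (Finset.subset_univ _)
      omega

lemma reduce {N : ℕ} (G : SimpleGraph (Fin N)) (t d : ℕ) (a : Fin N →₀ ℕ)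
    (h : CovW G t a) (hd : ∑ i, a i = 2 * t + d) :
    ∃ b : Fin N →₀ ℕ, b ≤ a ∧ CovW G t b ∧ ∑ i, b i = 2 * t := by
  induction d generalizing a with
  | zero => exact ⟨a, le_rfl, h, hd⟩
  | succ d ih =>
    by_cases hr : ∃ i, 0 < a i ∧ ∀ S, IsVertexCover G S → i ∈ S → t < ∑ j ∈ S, a j
    · obtain ⟨i, hi, hS⟩ := hr
      have hle : Finsupp.single i 1 ≤ a := by
        rw [Finsupp.single_le_iff]; exact hi
      have hsum : ∀ S : Finset (Fin N), ∑ j ∈ S, a j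
          = ∑ j ∈ S, (a - Finsupp.single i 1 : Fin N →₀ ℕ) j + if i ∈ S then 1 else 0 := by
        intro S
        conv_lhs => rw [← tsub_add_cancel_of_le hle]
        simp only [Finsupp.add_apply, Finset.sum_add_distrib]
        congr 1
        simp [Finsupp.single_apply]
      obtain ⟨b, hb, hb2, hb3⟩ := ih (a - Finsupp.single i 1) (by
          intro S hc
          have h1 := hsum S
          have h2 := h S hc
          have h3 := hS S hc
          by_cases hiS : i ∈ S
          · have := h3 hiS
            simp only [hiS, if_true] at h1
            omega
          · simp only [hiS, if_false] at h1
            omega) (by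
          have h1 := hsum Finset.univ
          simp only [Finset.mem_univ, if_true] at h1
          omega)
      exact ⟨b, hb.trans tsub_le_self, hb2, hb3⟩
    · exfalso
      push Not at hr
      have hex : ∃ S, IsVertexCover G S ∧ ∑ j ∈ S, a j ≤ t := by
        have : ∃ i, 0 < a i := by
          by_contra hcon
          push Not at hcon
          have : ∑ i, a i = 0 := Finset.sum_eq_zero fun i _ => by have := hcon i; omega
          omega
        obtain ⟨i, hi⟩ := this
        obtain ⟨S, h1, h2, h3⟩ := hr i hi
        exact ⟨S, h1, h3⟩
      obtain ⟨S, hS, hSt⟩ := hex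
      have := core_corona G t a h hr Sᶜ Sᶜ subset_rfl (by
        intro x hx y hy hxy
        rw [Finset.mem_compl] at hx hy
        rcases hS hxy with h | h <;> contradiction) (by
        have := Finset.sum_add_sum_compl S a
        omega)
      omega

section cyc

open scoped Fin.NatCast Fin.CommRing

lemma adj_iff {n : ℕ} (hn : 1 ≤ n) (i j : Fin (2 * n + 1)) :
    (cycleGraph (2 * n + 1)).Adj i j ↔ (j = i + 1 ∨ i = j + 1) := by
  have h1 : ∀ i j : Fin (2 * n + 1), ((j : ℕ) = ((i : ℕ) + 1) % (2 * n + 1)) ↔ j = i + 1 := by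
    intro i j
    rw [Fin.ext_iff, Fin.val_add, Fin.val_one', Nat.add_mod_mod]
  have h2 : ∀ i : Fin (2 * n + 1), i ≠ i + 1 := by
    intro i hi
    have := (h1 i i).2 hi
    have hl := i.isLt
    rcases Nat.lt_or_ge ((i : ℕ) + 1) (2 * n + 1) with h | h
    · rw [Nat.mod_eq_of_lt h] at this; omega
    · have : (i : ℕ) + 1 = 2 * n + 1 := by omega
      simp_all
  simp only [cycleGraph, SimpleGraph.fromRel_adj, h1]
  constructor
  · exact fun h => h.2
  · intro h
    refine ⟨?_, h⟩
    rintro rfl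
    rcases h with h | h <;> exact h2 _ h

/-- the alternating independent set sum avoiding the edge `{i, i+1}` -/
def usum {n : ℕ} (a : Fin (2 * n + 1) → ℕ) (i : Fin (2 * n + 1)) : ℕ :=
  ∑ k ∈ Finset.range n, a (i + ((2 * k + 2 : ℕ) : Fin (2 * n + 1)))

lemma sum_shift {n : ℕ} (a : Fin (2 * n + 1) → ℕ) (i : Fin (2 * n + 1)) :
    ∑ j ∈ Finset.range (2 * n), a (i + ((j + 1 : ℕ) : Fin (2 * n + 1))) + a i = ∑ j, a j := by
  have h1 : ∑ j, a j = ∑ j, a (i + j) := (Equiv.sum_comp (Equiv.addLeft i) a).symm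
  have h2 : ∑ j : Fin (2 * n + 1), a (i + j)
      = ∑ j ∈ Finset.range (2 * n + 1), a (i + (j : Fin (2 * n + 1))) := by
    rw [← Fin.sum_univ_eq_sum_range (fun j => a (i + (j : Fin (2 * n + 1))))]
    simp
  rw [h1, h2, Finset.sum_range_succ']
  simp

lemma sum_even_odd (f : ℕ → ℕ) (n : ℕ) :
    ∑ k ∈ Finset.range n, f (2 * k + 2) + ∑ k ∈ Finset.range n, f (2 * k + 1)
      = ∑ j ∈ Finset.range (2 * n), f (j + 1) := by
  induction n with
  | zero => simp
  | succ n ih =>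
    rw [Finset.sum_range_succ, Finset.sum_range_succ, show 2 * (n + 1) = 2 * n + 1 + 1 by ring,
      Finset.sum_range_succ, Finset.sum_range_succ, ← ih]
    ring

lemma usum_add {n : ℕ} (a : Fin (2 * n + 1) → ℕ) (i : Fin (2 * n + 1)) :
    usum a i + usum a (i - 1) + a i = ∑ j, a j := by
  rw [← sum_shift a i, ← sum_even_odd (fun j => a (i + (j : Fin (2 * n + 1)))) n]
  unfold usum
  congr 2
  refine Finset.sum_congr rfl fun k _ => ?_
  congr 1
  push_cast
  ring

lemma sum_usum {n : ℕ} (a : Fin (2 * n + 1) → ℕ) : ∑ i, usum a i = n * ∑ i, a i := by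
  unfold usum
  rw [Finset.sum_comm]
  have h : ∀ k ∈ Finset.range n,
      ∑ x, a (x + ((2 * k + 2 : ℕ) : Fin (2 * n + 1))) = ∑ i, a i :=
    fun k _ => Equiv.sum_comp (Equiv.addRight ((2 * k + 2 : ℕ) : Fin (2 * n + 1))) a
  rw [Finset.sum_congr rfl h]
  simp

lemma cast_inj' {n x y : ℕ} (hx : x < 2 * n + 1) (hy : y < 2 * n + 1)
    (h : (x : Fin (2 * n + 1)) = y) : x = y := by
  have := congrArg Fin.val h
  simpa [Fin.val_natCast, Nat.mod_eq_of_lt hx, Nat.mod_eq_of_lt hy] using this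

lemma usum_le {n : ℕ} (hn : 1 ≤ n) (t : ℕ) (a : Fin (2 * n + 1) → ℕ)
    (h : CovW (cycleGraph (2 * n + 1)) t a) (i : Fin (2 * n + 1)) :
    t + usum a i ≤ ∑ j, a j := by
  set U := (Finset.range n).image (fun k => i + ((2 * k + 2 : ℕ) : Fin (2 * n + 1))) with hU
  have hsum : ∑ j ∈ U, a j = usum a i := by
    rw [hU, Finset.sum_image]
    · rfl
    · intro x hx y hy hxy
      simp only [Finset.coe_range, Set.mem_Iio] at hx hy
      have := cast_inj' (by omega) (by omega) (add_left_cancel hxy)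
      omega
  have hind : ∀ x ∈ U, x + 1 ∉ U := by
    intro x hx hx1
    simp only [hU, Finset.mem_image, Finset.mem_range] at hx hx1
    obtain ⟨k, hk, rfl⟩ := hx
    obtain ⟨l, hl, hlk⟩ := hx1
    rw [add_assoc] at hlk
    have h3 := add_left_cancel hlk
    have h4 : ((2 * l + 2 : ℕ) : Fin (2 * n + 1)) = ((2 * k + 3 : ℕ) : Fin (2 * n + 1)) := by
      rw [h3]; push_cast; ring
    rcases Nat.lt_or_ge (2 * k + 3) (2 * n + 1) with hlt | hge
    · have := cast_inj' (by omega) hlt h4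
      omega
    · have e : 2 * k + 3 = 2 * n + 1 := by omega
      rw [e, Fin.natCast_self] at h4
      have := cast_inj' (n := n) (x := 2 * l + 2) (y := 0) (by omega) (by omega) (by simpa using h4)
      omega
  have hc : IsVertexCover (cycleGraph (2 * n + 1)) Uᶜ := by
    intro x y hxy
    rw [adj_iff hn] at hxy
    simp only [Finset.mem_compl]
    rcases hxy with rfl | rfl
    · by_contra! hh; exact hind _ hh.1 hh.2
    · by_contra! hh; exact hind _ hh.2 hh.1
  have := h _ hc
  have := Finset.sum_add_sum_compl U a
  omega

lemma deg_lower {n t : ℕ} (hn : 1 ≤ n) (ht2 : t ≤ 2 * n + 1) (a : Fin (2 * n + 1) → ℕ)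
    (h : CovW (cycleGraph (2 * n + 1)) t a) : 2 * t ≤ ∑ j, a j + 1 := by
  have h1 : ∑ i : Fin (2 * n + 1), (t + usum a i) ≤ ∑ i : Fin (2 * n + 1), ∑ j, a j :=
    Finset.sum_le_sum fun i _ => usum_le hn t a h i
  rw [Finset.sum_add_distrib, sum_usum] at h1
  simp only [Finset.sum_const, Finset.card_univ, Fintype.card_fin, smul_eq_mul] at h1
  by_contra! hcon
  nlinarith

/-- the exponent `x_1 ⋯ x_{2n+1} ∏ e_i^{m_i}` -/
def expo {n : ℕ} (m : Fin (2 * n + 1) → ℕ) : Fin (2 * n + 1) →₀ ℕ :=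
  Finsupp.equivFunOnFinite.symm fun i => 1 + m i + m (i - 1)

lemma expo_apply {n : ℕ} (m : Fin (2 * n + 1) → ℕ) (i) : expo m i = 1 + m i + m (i - 1) := rfl

lemma sum_sub_one {n : ℕ} (m : Fin (2 * n + 1) → ℕ) : ∑ i, m (i - 1) = ∑ i, m i :=
  Equiv.sum_comp (Equiv.subRight (1 : Fin (2 * n + 1))) m

lemma sum_expo {n : ℕ} (m : Fin (2 * n + 1) → ℕ) :
    ∑ i, expo m i = 2 * n + 1 + 2 * ∑ i, m i := by
  simp only [expo_apply, Finset.sum_add_distrib, sum_sub_one]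
  simp
  ring

lemma cover_edge_sum {n : ℕ} (hn : 1 ≤ n) (m : Fin (2 * n + 1) → ℕ) (S : Finset (Fin (2 * n + 1)))
    (hS : IsVertexCover (cycleGraph (2 * n + 1)) S) :
    ∑ i, m i ≤ ∑ i ∈ S, (m i + m (i - 1)) := by
  have e : ∀ f : Fin (2 * n + 1) → ℕ, ∑ j ∈ S, f j = ∑ j, if j ∈ S then f j else 0 := by
    intro s; simp
  rw [Finset.sum_add_distrib, e, e (fun i => m (i - 1)),
    ← Equiv.sum_comp (Equiv.addRight (1 : Fin (2 * n + 1))) (fun j => if j ∈ S then m (j - 1) else 0),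
    ← Finset.sum_add_distrib]
  refine Finset.sum_le_sum fun i _ => ?_
  have := hS ((adj_iff hn i (i + 1)).2 (Or.inl rfl))
  simp only [Equiv.coe_addRight, add_sub_cancel_right]
  rcases this with h | h <;> simp [h]

lemma covW_expo {n t : ℕ} (hn : 1 ≤ n) (m : Fin (2 * n + 1) → ℕ) (hm : n + 1 + ∑ i, m i = t) :
    CovW (cycleGraph (2 * n + 1)) t (expo m) := by
  intro S hS
  have h1 := cover_edge_sum hn m S hS
  have h2 := cover_edge_sum hn (fun _ => 1) S hS
  simp only [expo_apply, add_assoc]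
  rw [Finset.sum_add_distrib]
  simp at h2 ⊢
  omega

lemma expo_surj {n t : ℕ} (hn : 1 ≤ n) (a : Fin (2 * n + 1) →₀ ℕ)
    (h : CovW (cycleGraph (2 * n + 1)) t a) (hd : ∑ i, a i + 1 = 2 * t) :
    ∃ m : Fin (2 * n + 1) → ℕ, n + 1 + ∑ i, m i = t ∧ expo m = a := by
  have he : expo (fun i => t - 1 - usum a i) = a := by
    ext i
    rw [expo_apply]
    have h1 := usum_add a i
    have h2 := usum_le hn t a h i
    have h3 := usum_le hn t a h (i - 1)
    omega
  refine ⟨_, ?_, he⟩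
  have := sum_expo (n := n) (fun i => t - 1 - usum a i)
  rw [he] at this
  omega

lemma usum_expo {n : ℕ} (m : Fin (2 * n + 1) → ℕ) (i : Fin (2 * n + 1)) :
    usum (expo m) i + m i = n + ∑ j, m j := by
  rw [← sum_shift m i, ← sum_even_odd (fun j => m (i + (j : Fin (2 * n + 1)))) n, ← add_assoc]
  congr 1
  unfold usum
  simp only [expo_apply, Finset.sum_add_distrib]
  simp only [Finset.sum_const, Finset.card_range, smul_eq_mul, mul_one, add_assoc]
  congr 2
  refine Finset.sum_congr rfl fun k _ => ?_
  congr 1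
  push_cast
  ring

lemma expo_inj {n s : ℕ} : Set.InjOn (expo (n := n)) {m | ∑ i, m i = s} := by
  intro m hm m' hm' h
  funext i
  have h1 := usum_expo m i
  have h2 := usum_expo m' i
  simp only [Set.mem_ofPred_eq] at hm hm'
  rw [h] at h1
  omega

lemma edge_decomp {n t : ℕ} (hn : 1 ≤ n) (a : Fin (2 * n + 1) →₀ ℕ)
    (h : CovW (cycleGraph (2 * n + 1)) t a) (hd : ∑ i, a i = 2 * t) :
    ∃ m : Fin (2 * n + 1) → ℕ, ∑ i, m i = t ∧ ∀ i, a i = m i + m (i - 1) := by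
  have he : ∀ i, a i = (t - usum a i) + (t - usum a (i - 1)) := by
    intro i
    have h1 := usum_add a i
    have h2 := usum_le hn t a h i
    have h3 := usum_le hn t a h (i - 1)
    omega
  refine ⟨fun i => t - usum a i, ?_, he⟩
  have h1 : ∑ i, a i = ∑ i, ((t - usum a i) + (t - usum a (i - 1))) :=
    Finset.sum_congr rfl fun i _ => he i
  rw [Finset.sum_add_distrib, sum_sub_one (fun i => t - usum a i)] at h1
  show ∑ i, (t - usum a i) = t
  omega

lemma count_identity (N s : ℕ) (hs : 1 ≤ s) :
    Nat.multichoose N s = ∑ ℓ ∈ Finset.Icc 1 N,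
      (if ℓ ≤ s then Nat.choose N ℓ * Nat.multichoose ℓ (s - ℓ) else 0) := by
  obtain ⟨r, rfl⟩ : ∃ r, s = r + 1 := ⟨s - 1, by omega⟩
  rw [Nat.multichoose_eq, show N + (r + 1) - 1 = N + r by omega, Nat.add_choose_eq,
    Finset.Nat.sum_antidiagonal_eq_sum_range_succ (fun i j => N.choose i * r.choose j)]
  have e : ∀ ℓ ∈ Finset.Icc 1 N, (if ℓ ≤ r + 1 then Nat.choose N ℓ * Nat.multichoose ℓ (r + 1 - ℓ) else 0)
      = if ℓ ≤ r + 1 then N.choose ℓ * r.choose (r + 1 - ℓ) else 0 := by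
    intro ℓ hℓ
    split_ifs with h
    · rw [Nat.multichoose_eq]; congr 2; omega
    · rfl
  rw [Finset.sum_congr rfl e, ← Finset.sum_filter]
  symm
  apply Finset.sum_subset
  · intro x hx
    simp at hx ⊢
    omega
  · intro x hx hx'
    simp at hx hx'
    rcases Nat.eq_zero_or_pos x with rfl | hp
    · simp
    · rw [Nat.choose_eq_zero_of_lt, zero_mul]
      by_contra hcon
      have := hx' hp (by omega)
      omega

end cyc

/-- exponents of the monomials of `D(t)` -/
def Dexp (n s : ℕ) : Set (Fin (2 * n + 1) →₀ ℕ) :=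
  expo '' {m : Fin (2 * n + 1) → ℕ | ∑ i, m i = s}

lemma mem_Dexp_iff {n t : ℕ} (hn : 1 ≤ n) (ht1 : n + 2 ≤ t) (ht2 : t ≤ 2 * n + 1)
    (a : Fin (2 * n + 1) →₀ ℕ) :
    a ∈ Dexp n (t - (n + 1)) ↔
      (∑ i, a i < 2 * t ∧ CovW (cycleGraph (2 * n + 1)) t a) := by
  constructor
  · rintro ⟨m, hm, rfl⟩
    have hm' : ∑ i, m i = t - (n + 1) := hm
    refine ⟨?_, covW_expo hn m (by omega)⟩
    rw [sum_expo]; omega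
  · rintro ⟨h1, h2⟩
    have := deg_lower hn ht2 a h2
    obtain ⟨m, h3, h4⟩ := expo_surj hn a h2 (by omega)
    refine ⟨m, ?_, h4⟩
    show ∑ i, m i = t - (n + 1)
    omega

lemma Dset_eq (K : Type*) [Field K] {n t : ℕ} (hn : 1 ≤ n) (ht1 : n + 2 ≤ t)
    (ht2 : t ≤ 2 * n + 1) :
    Dset K (cycleGraph (2 * n + 1)) t
      = (fun a => (monomial a (1 : K))) '' Dexp n (t - (n + 1)) := by
  ext p
  constructor
  · rintro ⟨a, rfl, h1, h2⟩
    exact ⟨a, (mem_Dexp_iff hn ht1 ht2 a).2 ⟨h1, (covW_iff _ _ _).2 h2⟩, rfl⟩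
  · rintro ⟨a, ha, rfl⟩
    have := (mem_Dexp_iff hn ht1 ht2 a).1 ha
    exact ⟨a, rfl, this.1, (covW_iff _ _ _).1 this.2⟩

lemma compositions_eq (N s : ℕ) : {m : Fin N → ℕ | ∑ i, m i = s}
    = ((Finset.univ : Finset (Fin N)).piAntidiag s : Set (Fin N → ℕ)) := by
  ext m; simp

lemma Dexp_finite (n s : ℕ) : (Dexp n s).Finite := by
  unfold Dexp
  rw [compositions_eq]
  exact (Finset.finite_toSet _).image _

lemma Dexp_ncard (n s : ℕ) : (Dexp n s).ncard = Nat.multichoose (2 * n + 1) s := by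
  unfold Dexp
  rw [Set.InjOn.ncard_image expo_inj, ← Nat.card_coe_set_eq]
  change Nat.card {m : Fin (2 * n + 1) → ℕ // ∑ i, m i = s} = _
  rw [← Nat.card_congr (Sym.equivNatSumOfFintype (Fin (2 * n + 1)) s), Nat.card_eq_fintype_card,
    Sym.card_sym_eq_multichoose, Fintype.card_fin]

lemma monomial_injective (K : Type*) [Field K] (N : ℕ) :
    Function.Injective (fun a : Fin N →₀ ℕ => (monomial a (1 : K))) :=
  fun _ _ h => monomial_left_injective one_ne_zero h

lemma varIdeal_pow_le (K : Type*) [Field K] (N : ℕ) (S : Finset (Fin N)) (t : ℕ) :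
    varIdeal K N S ^ t ≤
      Ideal.span ((fun a => monomial a (1 : K)) '' {a : Fin N →₀ ℕ | t ≤ ∑ i ∈ S, a i}) := by
  induction t with
  | zero =>
    intro f _
    rw [mem_ideal_span_monomial_image]
    intro a _
    exact ⟨a, Nat.zero_le _, le_rfl⟩
  | succ t ih =>
    rw [pow_succ]
    refine (Ideal.mul_mono_left ih).trans ?_
    unfold varIdeal
    rw [Ideal.span_mul_span', Ideal.span_le]
    rintro _ ⟨_, ⟨a, ha, rfl⟩, _, ⟨i, hi, rfl⟩, rfl⟩
    apply Ideal.subset_span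
    refine ⟨a + Finsupp.single i 1, ?_, ?_⟩
    · have ha' : t ≤ ∑ i ∈ S, a i := ha
      have hi' : i ∈ S := hi
      show t + 1 ≤ ∑ j ∈ S, (a + Finsupp.single i 1 : Fin N →₀ ℕ) j
      simp only [Finsupp.add_apply, Finset.sum_add_distrib]
      have : ∑ j ∈ S, (Finsupp.single i 1 : Fin N →₀ ℕ) j = 1 := by
        simp [Finsupp.single_apply, hi']
      omega
    · simp [X, monomial_mul]

lemma monomial_mem_varIdeal_pow (K : Type*) [Field K] (N : ℕ) (S : Finset (Fin N)) (t : ℕ)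
    (a : Fin N →₀ ℕ) (h : t ≤ ∑ i ∈ S, a i) : monomial a (1 : K) ∈ varIdeal K N S ^ t := by
  rw [monomial_eq, Finsupp.prod_fintype _ _ (by simp), C_1, one_mul,
    ← Finset.prod_mul_prod_compl S]
  apply Ideal.mul_mem_right
  apply Ideal.pow_le_pow_right h
  rw [← Finset.prod_pow_eq_pow_sum]
  refine Ideal.prod_mem_prod fun i hi => Ideal.pow_mem_pow ?_ _
  exact Ideal.subset_span ⟨i, hi, rfl⟩

lemma mem_symbolicPower (K : Type*) [Field K] {N : ℕ} (G : SimpleGraph (Fin N)) (t : ℕ)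
    (f : MvPolynomial (Fin N) K) :
    f ∈ symbolicPower K G t ↔ ∀ a ∈ f.support, CovW G t a := by
  simp only [symbolicPower, Ideal.mem_iInf]
  constructor
  · intro h a ha
    rw [covW_iff]
    intro S hS
    have := varIdeal_pow_le K N S t (h S hS)
    rw [mem_ideal_span_monomial_image] at this
    obtain ⟨b, hb, hle⟩ := this a ha
    have hb' : t ≤ ∑ i ∈ S, b i := hb
    exact hb'.trans (Finset.sum_le_sum fun i _ => hle i)
  · intro h S hS
    rw [f.as_sum]
    refine Ideal.sum_mem _ fun a ha => ?_
    rw [← mul_one (coeff a f), ← C_mul_monomial]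
    exact Ideal.mul_mem_left _ _ (monomial_mem_varIdeal_pow K N S t a (h a ha S hS.1))

lemma edgeIdeal_pow_le (K : Type*) [Field K] {N : ℕ} (G : SimpleGraph (Fin N)) (t : ℕ) :
    edgeIdeal K G ^ t ≤ symbolicPower K G t := by
  unfold symbolicPower
  refine le_iInf fun S => le_iInf fun hS => Ideal.pow_right_mono ?_ t
  unfold edgeIdeal
  rw [Ideal.span_le]
  rintro _ ⟨i, j, hij, rfl⟩
  rcases hS.1 hij with h | h
  · exact Ideal.mul_mem_right _ _ (Ideal.subset_span ⟨i, h, rfl⟩)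
  · exact Ideal.mul_mem_left _ _ (Ideal.subset_span ⟨j, h, rfl⟩)

lemma edgeIdeal_pow_deg (K : Type*) [Field K] {N : ℕ} (G : SimpleGraph (Fin N)) (t : ℕ) :
    edgeIdeal K G ^ t ≤
      Ideal.span ((fun a => monomial a (1 : K)) '' {a : Fin N →₀ ℕ | 2 * t ≤ ∑ i, a i}) := by
  have h1 : edgeIdeal K G ≤ varIdeal K N Finset.univ ^ 2 := by
    unfold edgeIdeal
    rw [Ideal.span_le]
    rintro _ ⟨i, j, hij, rfl⟩
    rw [pow_two]
    exact Ideal.mul_mem_mul (Ideal.subset_span ⟨i, by simp, rfl⟩)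
      (Ideal.subset_span ⟨j, by simp, rfl⟩)
  have h2 := Ideal.pow_right_mono h1 t
  rw [← pow_mul] at h2
  exact h2.trans (varIdeal_pow_le K N Finset.univ (2 * t))

lemma monomial_mem_edgeIdeal_pow (K : Type*) [Field K] {n t : ℕ} (hn : 1 ≤ n)
    (a : Fin (2 * n + 1) →₀ ℕ) (m : Fin (2 * n + 1) → ℕ) (hm : ∑ i, m i = t)
    (ha : ∀ i, a i = m i + m (i - 1)) :
    monomial a (1 : K) ∈ edgeIdeal K (cycleGraph (2 * n + 1)) ^ t := by
  have : monomial a (1 : K) = ∏ i, (X i * X (i + 1)) ^ m i := by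
    rw [monomial_eq, Finsupp.prod_fintype _ _ (by simp), C_1, one_mul]
    simp only [ha, pow_add, mul_pow, Finset.prod_mul_distrib]
    congr 1
    rw [← Equiv.prod_comp (Equiv.addRight (1 : Fin (2 * n + 1)))]
    simp
  rw [this, ← hm, ← Finset.prod_pow_eq_pow_sum]
  refine Ideal.prod_mem_prod fun i _ => Ideal.pow_mem_pow (Ideal.subset_span ?_) _
  exact ⟨i, i + 1, (adj_iff hn _ _).2 (Or.inl rfl), rfl⟩

lemma symbolicPower_eq (K : Type*) [Field K] {n t : ℕ} (hn : 1 ≤ n) (ht1 : n + 2 ≤ t)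
    (ht2 : t ≤ 2 * n + 1) :
    symbolicPower K (cycleGraph (2 * n + 1)) t = edgeIdeal K (cycleGraph (2 * n + 1)) ^ t
      + Ideal.span ((fun a => (monomial a (1 : K))) '' Dexp n (t - (n + 1))) := by
  apply le_antisymm
  · intro f hf
    rw [mem_symbolicPower] at hf
    rw [f.as_sum]
    refine Ideal.sum_mem _ fun a ha => ?_
    rw [← mul_one (coeff a f), ← C_mul_monomial]
    apply Ideal.mul_mem_left
    have hw := hf a ha
    by_cases hd : ∑ i, a i < 2 * t
    · exact Ideal.mem_sup_right
        (Ideal.subset_span ⟨a, (mem_Dexp_iff hn ht1 ht2 a).2 ⟨hd, hw⟩, rfl⟩)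
    · apply Ideal.mem_sup_left
      obtain ⟨b, hb, hb1, hb2⟩ := reduce _ t (∑ i, a i - 2 * t) a hw (by omega)
      obtain ⟨m, hm, hm2⟩ := edge_decomp hn b hb1 hb2
      have := monomial_mem_edgeIdeal_pow K hn b m hm hm2
      rw [← tsub_add_cancel_of_le hb, ← mul_one (1 : K), ← monomial_mul]
      exact Ideal.mul_mem_left _ _ this
  · refine sup_le (edgeIdeal_pow_le K _ t) ?_
    rw [Ideal.span_le]
    rintro _ ⟨a, ha, rfl⟩
    show _ ∈ symbolicPower K _ t
    rw [mem_symbolicPower]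
    intro b hb
    have := support_monomial_subset hb
    rw [Finset.mem_singleton] at this
    rw [this]
    exact ((mem_Dexp_iff hn ht1 ht2 a).1 ha).2

lemma coeff_mul_low (K : Type*) [Field K] {N d : ℕ} (f g : MvPolynomial (Fin N) K)
    (hf : ∀ b ∈ f.support, d ≤ ∑ i, b i) (a : Fin N →₀ ℕ) (ha : ∑ i, a i ≤ d) :
    coeff a (g * f) = coeff 0 g * coeff a f := by
  rw [coeff_mul]
  rw [Finset.sum_eq_single_of_mem (0, a) (by simp)]
  rintro ⟨u, v⟩ huv hne
  rw [Finset.HasAntidiagonal.mem_antidiagonal] at huv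
  simp only at huv ⊢
  by_cases hv : v ∈ f.support
  · exfalso
    have h1 := hf v hv
    have h2 : ∑ i, a i = ∑ i, u i + ∑ i, v i := by
      rw [← huv]; simp [Finset.sum_add_distrib]
    have h3 : ∑ i, u i = 0 := by omega
    have h4 : u = 0 := by
      ext i
      exact Finset.sum_eq_zero_iff.1 h3 i (Finset.mem_univ _)
    apply hne
    rw [h4, zero_add] at huv
    rw [h4, huv]
  · rw [notMem_support_iff.1 hv, mul_zero]

lemma card_lower (K : Type*) [Field K] {n t : ℕ} (hn : 1 ≤ n) (ht1 : n + 2 ≤ t)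
    (ht2 : t ≤ 2 * n + 1) (F : Finset (MvPolynomial (Fin (2 * n + 1)) K))
    (hF : symbolicPower K (cycleGraph (2 * n + 1)) t = edgeIdeal K (cycleGraph (2 * n + 1)) ^ t
      + Ideal.span (F : Set (MvPolynomial (Fin (2 * n + 1)) K))) :
    (Dexp n (t - (n + 1))).ncard ≤ F.card := by
  classical
  set D := Dexp n (t - (n + 1)) with hD
  have hfin : Finite D := Dexp_finite n _
  have : Fintype D := Fintype.ofFinite D
  let φ : MvPolynomial (Fin (2 * n + 1)) K →ₗ[K] (D → K) :=
    LinearMap.pi fun a => lcoeff K (a : Fin (2 * n + 1) →₀ ℕ)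
  have hφ : ∀ f a, φ f a = coeff (a : Fin (2 * n + 1) →₀ ℕ) f := fun f a => rfl
  have hFs : ∀ f ∈ F, f ∈ symbolicPower K (cycleGraph (2 * n + 1)) t := by
    intro f hf
    rw [hF]
    exact Ideal.mem_sup_right (Ideal.subset_span hf)
  have hlow : ∀ f ∈ symbolicPower K (cycleGraph (2 * n + 1)) t, ∀ b ∈ f.support,
      2 * t - 1 ≤ ∑ i, b i := by
    intro f hf b hb
    have := deg_lower hn ht2 b ((mem_symbolicPower K _ t f).1 hf b hb)
    omega
  have hDdeg : ∀ a ∈ D, ∑ i, a i < 2 * t := fun a ha => ((mem_Dexp_iff hn ht1 ht2 a).1 ha).1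
  have hedge : ∀ f ∈ edgeIdeal K (cycleGraph (2 * n + 1)) ^ t, φ f = 0 := by
    intro f hf
    have h1 := edgeIdeal_pow_deg K _ t hf
    rw [mem_ideal_span_monomial_image] at h1
    funext a
    rw [hφ]
    by_contra hne
    obtain ⟨b, hb, hle⟩ := h1 a (mem_support_iff.2 hne)
    have hb' : 2 * t ≤ ∑ i, b i := hb
    have h2 : ∑ i, b i ≤ ∑ i, (a : Fin (2 * n + 1) →₀ ℕ) i := Finset.sum_le_sum fun i _ => hle i
    have := hDdeg a a.2
    omega
  have hspan : ∀ f ∈ Ideal.span (F : Set (MvPolynomial (Fin (2 * n + 1)) K)),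
      φ f ∈ Submodule.span K ((F.image φ : Finset (D → K)) : Set (D → K)) := by
    intro f hf
    refine Submodule.span_induction (p := fun f _ => φ f ∈
      Submodule.span K ((F.image φ : Finset (D → K)) : Set (D → K)) ∧
      f ∈ symbolicPower K (cycleGraph (2 * n + 1)) t) ?_ ?_ ?_ ?_ hf |>.1
    · intro f hf
      refine ⟨Submodule.subset_span ?_, hFs f hf⟩
      rw [Finset.coe_image]
      exact ⟨f, hf, rfl⟩
    · exact ⟨by simp, Ideal.zero_mem _⟩
    · intro f g _ _ h1 h2
      exact ⟨by rw [map_add]; exact Submodule.add_mem _ h1.1 h2.1, Ideal.add_mem _ h1.2 h2.2⟩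
    · intro g f _ h
      refine ⟨?_, Ideal.mul_mem_left _ _ h.2⟩
      have : φ (g • f) = coeff 0 g • φ f := by
        funext a
        rw [smul_eq_mul, Pi.smul_apply, hφ, hφ, smul_eq_mul]
        have := hDdeg a a.2
        exact coeff_mul_low K f g (hlow f h.2) a (by omega)
      rw [this]
      exact Submodule.smul_mem _ _ h.1
  have htop : Submodule.span K ((F.image φ : Finset (D → K)) : Set (D → K)) = ⊤ := by
    rw [eq_top_iff, ← (Pi.basisFun K D).span_eq, Submodule.span_le]
    rintro _ ⟨a, rfl⟩
    have hm : monomial (a : Fin (2 * n + 1) →₀ ℕ) (1 : K)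
        ∈ symbolicPower K (cycleGraph (2 * n + 1)) t := by
      rw [symbolicPower_eq K hn ht1 ht2]
      exact Ideal.mem_sup_right (Ideal.subset_span ⟨a, a.2, rfl⟩)
    have he : (Pi.basisFun K D) a = φ (monomial (a : Fin (2 * n + 1) →₀ ℕ) (1 : K)) := by
      funext b
      rw [hφ, coeff_monomial, Pi.basisFun_apply, Pi.single_apply]
      simp only [Subtype.ext_iff, eq_comm]
    rw [he]
    rw [hF] at hm
    obtain ⟨g, hg, h, hh, hgh⟩ := Submodule.mem_sup.1 hm
    rw [← hgh, map_add, hedge g hg, zero_add]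
    exact hspan h hh
  have h1 := finrank_span_finset_le_card (R := K) (F.image φ)
  rw [Set.finrank, htop, finrank_top, Module.finrank_fintype_fun_eq_card] at h1
  rw [← Nat.card_coe_set_eq, Nat.card_eq_fintype_card]
  exact h1.trans Finset.card_image_le

lemma sdefect_eq_card (K : Type*) [Field K] {n t : ℕ} (hn : 1 ≤ n) (ht1 : n + 2 ≤ t)
    (ht2 : t ≤ 2 * n + 1) :
    sdefect K (cycleGraph (2 * n + 1)) t = (Dexp n (t - (n + 1))).ncard := by
  classical
  have hfin := Dexp_finite n (t - (n + 1))
  have hmem : (Dexp n (t - (n + 1))).ncard ∈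
      {c | ∃ F : Finset (MvPolynomial (Fin (2 * n + 1)) K), F.card = c ∧
    symbolicPower K (cycleGraph (2 * n + 1)) t = edgeIdeal K (cycleGraph (2 * n + 1)) ^ t
      + Ideal.span (F : Set (MvPolynomial (Fin (2 * n + 1)) K))} := by
    refine ⟨hfin.toFinset.image (fun a => monomial a (1 : K)), ?_, ?_⟩
    · rw [Finset.card_image_of_injective _ (monomial_injective K _),
        Set.ncard_eq_toFinset_card _ hfin]
    · rw [Finset.coe_image, hfin.coe_toFinset]
      exact symbolicPower_eq K hn ht1 ht2
  apply le_antisymm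
  · exact Nat.sInf_le hmem
  · refine le_csInf ⟨_, hmem⟩ ?_
    rintro c ⟨F, rfl, hF⟩
    exact card_lower K hn ht1 ht2 F hF

lemma rhs_eq {n t : ℕ} (ht1 : n + 2 ≤ t) : Nat.multichoose (2 * n + 1) (t - (n + 1))
    = ∑ ℓ ∈ Finset.Icc 1 (2 * n + 1),
            (if n + 1 + ℓ ≤ t then
              Nat.choose (2 * n + 1) ℓ * Nat.multichoose ℓ (t - (n + 1) - ℓ)
            else 0) := by
  rw [count_identity _ _ (by omega)]
  refine Finset.sum_congr rfl fun ℓ _ => ?_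
  by_cases h : n + 1 + ℓ ≤ t
  · rw [if_pos h, if_pos (by omega)]
  · rw [if_neg h, if_neg (by omega)]

/-- For `n+2 ≤ t ≤ 2n+1`: every monomial of `D(t)` has degree exactly `2t-1`;
the cardinality of `D(t)` is `Σ_{ℓ=1}^{2n+1} C(2n+1,ℓ)·((ℓ multichoose t-(n+1)-ℓ))`
(with multichoose of a negative number interpreted as `0`); and the symbolic
defect of `I(C_{2n+1})` at `t` equals this sum. -/
theorem sdefect_cycle (K : Type*) [Field K] (n t : ℕ)
    (hn : 1 ≤ n) (ht1 : n + 2 ≤ t) (ht2 : t ≤ 2 * n + 1) :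
    (∀ a : Fin (2 * n + 1) →₀ ℕ,
      (monomial a (1 : K)) ∈ Dset K (cycleGraph (2 * n + 1)) t → ∑ i, a i = 2 * t - 1)
    ∧ (Dset K (cycleGraph (2 * n + 1)) t).ncard
        = ∑ ℓ ∈ Finset.Icc 1 (2 * n + 1),
            (if n + 1 + ℓ ≤ t then
              Nat.choose (2 * n + 1) ℓ * Nat.multichoose ℓ (t - (n + 1) - ℓ)
            else 0)
    ∧ sdefect K (cycleGraph (2 * n + 1)) t
        = ∑ ℓ ∈ Finset.Icc 1 (2 * n + 1),
            (if n + 1 + ℓ ≤ t then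
              Nat.choose (2 * n + 1) ℓ * Nat.multichoose ℓ (t - (n + 1) - ℓ)
            else 0) := by
  refine ⟨?_, ?_, ?_⟩
  · rintro a ⟨b, hab, h1, h2⟩
    obtain rfl : a = b := monomial_injective K _ hab
    have := deg_lower hn ht2 a ((covW_iff _ _ _).2 h2)
    omega
  · rw [Dset_eq K hn ht1 ht2, Set.ncard_image_of_injective _ (monomial_injective K _),
      Dexp_ncard, rhs_eq ht1]
  · rw [sdefect_eq_card K hn ht1 ht2, Dexp_ncard, rhs_eq ht1]
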